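/- For every k ≥ 0, the spherical coefficient v_k of the cubic matrix model satisfies v_k = 2·8^k·Γ((3k+2)/2)/((k+1)!·Γ((k+2)/2)), where Γ is the real Gamma function; in particular v_0, v_1, v_2, v_3, v_4, v_5 = 2, 12, 128, 1680, 24576, 384384. -/

import Mathlib

open Finset

open PowerSeries in
/-- A power series root `S` of `S ^ 3 - S + 8 X = 0` with `3 S ^ 2 - 1` nonzero satisfies a
linear differential equation of order two. -/
theorem linear_ode_of_cubic (S : ℝ⟦X⟧) (hS : S ^ 3 - S + 8 * X = 0) (ha : 3 * S ^ 2 - 1 ≠ 0) :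
    d⁄dX ℝ (d⁄dX ℝ S) = 432 * (X * d⁄dX ℝ (X * d⁄dX ℝ S)) - 48 * S := by
  have d3 : d⁄dX ℝ (3 : ℝ⟦X⟧) = 0 := by exact_mod_cast (d⁄dX ℝ).map_natCast 3
  have d8 : d⁄dX ℝ (8 : ℝ⟦X⟧) = 0 := by exact_mod_cast (d⁄dX ℝ).map_natCast 8
  have h1 : (3 * S ^ 2 - 1) * d⁄dX ℝ S = -8 := by
    have h := congrArg (d⁄dX ℝ) hS
    simp only [map_add, map_sub, map_zero, Derivation.leibniz, Derivation.leibniz_pow, d8,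
      derivative_X, smul_eq_mul, nsmul_eq_mul] at h
    push_cast at h
    linear_combination h
  have h2 : (3 * S ^ 2 - 1) * d⁄dX ℝ (d⁄dX ℝ S) + 6 * S * (d⁄dX ℝ S) ^ 2 = 0 := by
    have h := congrArg (d⁄dX ℝ) h1
    simp only [map_neg, map_sub, Derivation.leibniz, Derivation.leibniz_pow, d3, d8,
      Derivation.map_one_eq_zero, smul_eq_mul, nsmul_eq_mul] at h
    push_cast at h
    linear_combination h
  simp only [Derivation.leibniz, derivative_X, smul_eq_mul]
  generalize d⁄dX ℝ (d⁄dX ℝ S) = S₂ at *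
  generalize d⁄dX ℝ S = S₁ at *
  have h3 : (3 * S ^ 2 - 1) ^ 3 * S₂ = -384 * S := by
    linear_combination (3 * S ^ 2 - 1) ^ 2 * h2 - 6 * S * ((3 * S ^ 2 - 1) * S₁ - 8) * h1
  refine mul_left_cancel₀ (pow_ne_zero 3 ha) ?_
  linear_combination (1 - 432 * X ^ 2) * h3 - 432 * X * (3 * S ^ 2 - 1) ^ 2 * h1
    + (20736 * S * X + 2592 * S * (S - S ^ 3) + 432 * (3 * S ^ 2 - 1) ^ 2) * hS

open PowerSeries in
theorem spherical_v_recurrence (u v : ℕ → ℤ)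
    (hu0 : u 0 = 1)
    (hu : ∀ k : ℕ, u (k + 1) = 2 * ∑ p ∈ Finset.range (k + 1), u (k - p) * v p)
    (hv : ∀ k : ℕ, v k = 2 * u k + ∑ p ∈ Finset.range k, v (k - 1 - p) * v p) (k : ℕ) :
    ((k : ℝ) + 2) * (k + 3) * v (k + 2) = 48 * (3 * k + 2) * (3 * k + 4) * v k := by
  have coeff_conv (a : ℕ → ℤ) (n : ℕ) :
      coeff n (mk (fun i => (a i : ℝ)) * mk (fun i => (v i : ℝ))) =
        ((∑ p ∈ Finset.range (n + 1), a (n - p) * v p : ℤ) : ℝ) := by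
    rw [mul_comm, coeff_mul, Finset.Nat.sum_antidiagonal_eq_sum_range_succ_mk]
    push_cast
    exact Finset.sum_congr rfl fun p _ => by simp [mul_comm]
  have c2 : (2 : ℝ⟦X⟧) = C 2 := (map_ofNat C 2).symm
  have c48 : (48 : ℝ⟦X⟧) = C 48 := (map_ofNat C 48).symm
  have c432 : (432 : ℝ⟦X⟧) = C 432 := (map_ofNat C 432).symm
  set U : ℝ⟦X⟧ := mk fun i => (u i : ℝ)
  set V : ℝ⟦X⟧ := mk fun i => (v i : ℝ)
  have hU' : U = 1 + 2 * (X * (U * V)) := by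
    ext n
    rw [c2, map_add, coeff_C_mul]
    cases n with
    | zero => simp [U, hu0]
    | succ n =>
      rw [coeff_succ_X_mul, coeff_conv, coeff_one, coeff_mk, hu]
      push_cast
      simp
  have hV' : V = 2 * U + X * (V * V) := by
    ext n
    rw [c2, map_add, coeff_C_mul, coeff_mk, coeff_mk, hv]
    cases n with
    | zero => simp
    | succ n =>
      rw [coeff_succ_X_mul, coeff_conv]
      push_cast
      simp
  have hS : (1 - 2 * (X * V)) ^ 3 - (1 - 2 * (X * V)) + 8 * X = 0 := by
    linear_combination (-8 * X) * hU' - 4 * X * (1 - 2 * (X * V)) * hV'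
  have ha : 3 * (1 - 2 * (X * V)) ^ 2 - 1 ≠ 0 := by
    intro h
    have := congrArg constantCoeff h
    norm_num [map_ofNat (constantCoeff (R := ℝ)) 3] at this
  have hc (n : ℕ) : coeff (n + 1) (1 - 2 * (X * V)) = -2 * (v n : ℝ) := by
    rw [c2, map_sub, coeff_C_mul, coeff_succ_X_mul, coeff_one, coeff_mk]
    simp
  generalize 1 - 2 * (X * V) = S at hS ha hc
  have h := congrArg (coeff (k + 1)) (linear_ode_of_cubic _ hS ha)
  rw [c432, c48, map_sub, coeff_C_mul, coeff_C_mul, coeff_succ_X_mul] at h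
  simp only [coeff_derivative, coeff_succ_X_mul, hc] at h
  push_cast at h
  linear_combination (-1 / 2) * h

theorem gamma_ratio_recurrence (k : ℕ) :
    ((k : ℝ) + 2) * (k + 3) *
        (2 * 8 ^ (k + 2) * Real.Gamma ((3 * ((k + 2 : ℕ) : ℝ) + 2) / 2) /
          ((Nat.factorial (k + 2 + 1) : ℝ) * Real.Gamma ((((k + 2 : ℕ) : ℝ) + 2) / 2))) =
      48 * (3 * k + 2) * (3 * k + 4) *
        (2 * 8 ^ k * Real.Gamma ((3 * (k : ℝ) + 2) / 2) /
          ((Nat.factorial (k + 1) : ℝ) * Real.Gamma (((k : ℝ) + 2) / 2))) := by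
  have e1 : (3 * ((k + 2 : ℕ) : ℝ) + 2) / 2 = (3 * (k : ℝ) + 2) / 2 + 1 + 1 + 1 := by
    push_cast; ring
  have e2 : (((k + 2 : ℕ) : ℝ) + 2) / 2 = ((k : ℝ) + 2) / 2 + 1 := by push_cast; ring
  have hG : Real.Gamma (((k : ℝ) + 2) / 2) ≠ 0 := (Real.Gamma_pos_of_pos (by positivity)).ne'
  have hf : (Nat.factorial (k + 1) : ℝ) ≠ 0 := by positivity
  rw [e1, e2, Real.Gamma_add_one (by positivity), Real.Gamma_add_one (by positivity),
    Real.Gamma_add_one (by positivity), Real.Gamma_add_one (by positivity),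
    Nat.factorial_succ (k + 2), Nat.factorial_succ (k + 1)]
  push_cast
  field_simp
  ring

/-- Closed form for the spherical coefficients `v_k` of the cubic matrix model:
`v_k = 2·8^k·Γ((3k+2)/2)/((k+1)!·Γ((k+2)/2))`; in particular `v_0,…,v_5 =
2, 12, 128, 1680, 24576, 384384`. -/
theorem cubic_spherical_v_closed_form (u v : ℕ → ℤ)
    (hu0 : u 0 = 1)
    (hu : ∀ k : ℕ, u (k + 1) = 2 * ∑ p ∈ Finset.range (k + 1), u (k - p) * v p)
    (hv : ∀ k : ℕ, v k = 2 * u k + ∑ p ∈ Finset.range k, v (k - 1 - p) * v p) :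
    (∀ k : ℕ, (v k : ℝ) =
        2 * 8 ^ k * Real.Gamma ((3 * (k : ℝ) + 2) / 2) /
          ((Nat.factorial (k + 1) : ℝ) * Real.Gamma (((k : ℝ) + 2) / 2))) ∧
    v 0 = 2 ∧ v 1 = 12 ∧ v 2 = 128 ∧ v 3 = 1680 ∧ v 4 = 24576 ∧ v 5 = 384384 := by
  have hrec := spherical_v_recurrence u v hu0 hu hv
  have v0 : v 0 = 2 := by rw [hv 0]; simp [hu0]
  have v1 : v 1 = 12 := by rw [hv 1, hu 0]; simp [hu0, v0]
  have v2 : v 2 = 128 := by have := hrec 0; rify; norm_num [v0] at this; linarith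
  have v3 : v 3 = 1680 := by have := hrec 1; rify; norm_num [v1] at this; linarith
  have v4 : v 4 = 24576 := by have := hrec 2; rify; norm_num [v2] at this; linarith
  have v5 : v 5 = 384384 := by have := hrec 3; rify; norm_num [v3] at this; linarith
  refine ⟨fun k => ?_, v0, v1, v2, v3, v4, v5⟩
  induction k using Nat.twoStepInduction with
  | zero => simp [v0]
  | one =>
    have e : ((3 * ((1 : ℕ) : ℝ) + 2) / 2) = (((1 : ℕ) : ℝ) + 2) / 2 + 1 := by norm_num
    have hG : Real.Gamma ((((1 : ℕ) : ℝ) + 2) / 2) ≠ 0 :=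
      (Real.Gamma_pos_of_pos (by positivity)).ne'
    rw [e, Real.Gamma_add_one (by positivity), v1]
    field_simp
    norm_num [Nat.factorial]
  | more k ih _ =>
    have hk : ((k : ℝ) + 2) * (k + 3) ≠ 0 := by positivity
    refine mul_left_cancel₀ hk ?_
    rw [hrec, gamma_ratio_recurrence, ih]
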